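/- arXiv:2202.10578 — 2 statements merged into one kernel-verified Lean document; each statement's English description precedes it below -/
import Mathlib

section
/- Let X be a stochastically monotone Markov chain on S ⊆ ℝ with stationary distribution π, and r : S → ℝ non-decreasing with centered reward r_c(x) = r(x) − ∫ r dπ. If Σ_{j=0}^∞ |E_x r_c(X_j)| < ∞ for every x ∈ S, then g(x) := Σ_{j=0}^∞ E_x r_c(X_j) is a non-decreasing function solving Poisson's equation (P − I)g = −r_c, i.e. ∫ g(y) P(x,dy) − g(x) = −r_c(x) for all x. -/
open MeasureTheory Set ProbabilityTheory Filter Topology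
open scoped ENNReal

/-- Stochastic monotonicity on rays implies it on all upper sets. -/
lemma aux_upper {S : Set ℝ} (μ ν : Measure ↥S) [IsProbabilityMeasure μ] [IsProbabilityMeasure ν]
    (h : ∀ y : ↥S, μ {z : ↥S | y < z} ≤ ν {z : ↥S | y < z}) (U : Set ↥S) (hU : IsUpperSet U) :
    μ U ≤ ν U := by
  classical
  rcases Set.eq_empty_or_nonempty Uᶜ with hL | hL
  · have : U = univ := by simpa using hL
    simp [this]
  by_cases hmax : ∃ m ∈ Uᶜ, ∀ z ∈ Uᶜ, z ≤ m
  · obtain ⟨m, hm, hm'⟩ := hmax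
    have : U = {z | m < z} := by
      ext z
      constructor
      · intro hz
        by_contra hlt
        exact hm (hU (not_lt.mp hlt) hz)
      · intro hz
        by_contra hzU
        exact absurd (hm' z hzU) (not_le.mpr hz)
    rw [this]; exact h m
  · push Not at hmax
    obtain ⟨D, hDc, hDd⟩ := TopologicalSpace.exists_countable_dense (↥(Uᶜ : Set ↥S))
    have hcof : ∀ z ∈ Uᶜ, ∃ d ∈ D, z < (d : ↥S) := by
      intro z hz
      obtain ⟨w, hw, hzw⟩ := hmax z hz
      have hopen : IsOpen {d : ↥(Uᶜ : Set ↥S) | z < (d : ↥S)} :=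
        isOpen_Ioi.preimage continuous_subtype_val
      obtain ⟨d, hd, hdD⟩ := hDd.inter_open_nonempty _ hopen ⟨⟨w, hw⟩, hzw⟩
      exact ⟨d, hdD, hd⟩
    have hUeq : U = ⋂ d : ↥D, {z : ↥S | ((d : ↥(Uᶜ : Set ↥S)) : ↥S) < z} := by
      ext z
      simp only [mem_iInter, mem_ofPred_eq]
      constructor
      · intro hz d
        by_contra hlt
        exact d.1.2 (hU (not_lt.mp hlt) hz)
      · intro hz
        by_contra hzU
        obtain ⟨d, hd, hlt⟩ := hcof z hzU
        exact absurd (hz ⟨d, hd⟩) (not_lt.mpr hlt.le)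
    have : Countable ↥D := hDc.to_subtype
    obtain ⟨z0, hz0⟩ := hL
    obtain ⟨d0, hd0, -⟩ := hcof z0 hz0
    have hanti : Antitone (fun d : ↥D => {z : ↥S | ((d : ↥(Uᶜ : Set ↥S)) : ↥S) < z}) := by
      intro a b hab z hz
      exact lt_of_le_of_lt (show ((a : ↥(Uᶜ : Set ↥S)) : ↥S) ≤ b from hab) hz
    have hm : ∀ d : ↥D, MeasurableSet {z : ↥S | ((d : ↥(Uᶜ : Set ↥S)) : ↥S) < z} :=
      fun d => measurableSet_Ioi
    rw [hUeq, hanti.measure_iInter (fun d => (hm d).nullMeasurableSet) ⟨⟨d0, hd0⟩, measure_ne_top _ _⟩,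
      hanti.measure_iInter (fun d => (hm d).nullMeasurableSet) ⟨⟨d0, hd0⟩, measure_ne_top _ _⟩]
    exact iInf_mono fun d => h _

lemma aux_mono_lintegral {S : Set ℝ} (μ ν : Measure ↥S)
    (h : ∀ U : Set ↥S, IsUpperSet U → μ U ≤ ν U) (φ : ↥S → ℝ) (hφ : Monotone φ) :
    ∫⁻ z, ENNReal.ofReal (φ z) ∂μ ≤ ∫⁻ z, ENNReal.ofReal (φ z) ∂ν := by
  have hmono : Monotone (fun z => max (φ z) 0) := fun a b hab => max_le_max (hφ hab) le_rfl
  have e : ∀ z, ENNReal.ofReal (φ z) = ENNReal.ofReal (max (φ z) 0) := by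
    intro z
    rcases le_total (φ z) 0 with hz | hz
    · rw [max_eq_right hz, ENNReal.ofReal_of_nonpos hz, ENNReal.ofReal_zero]
    · rw [max_eq_left hz]
  simp_rw [e]
  rw [lintegral_eq_lintegral_meas_lt (f := fun z => max (φ z) 0) μ (.of_forall fun z => le_max_right _ _)
      hmono.measurable.aemeasurable,
    lintegral_eq_lintegral_meas_lt (f := fun z => max (φ z) 0) ν (.of_forall fun z => le_max_right _ _)
      hmono.measurable.aemeasurable]
  refine lintegral_mono fun t => h _ ?_
  intro a b hab (ha : t < _)
  exact lt_of_lt_of_le ha (hmono hab)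

lemma aux_anti_lintegral {S : Set ℝ} (μ ν : Measure ↥S) [IsProbabilityMeasure μ]
    [IsProbabilityMeasure ν]
    (h : ∀ U : Set ↥S, IsUpperSet U → μ U ≤ ν U) (φ : ↥S → ℝ) (hφ : Antitone φ) :
    ∫⁻ z, ENNReal.ofReal (φ z) ∂ν ≤ ∫⁻ z, ENNReal.ofReal (φ z) ∂μ := by
  have hmono : Antitone (fun z => max (φ z) 0) := fun a b hab => max_le_max (hφ hab) le_rfl
  have e : ∀ z, ENNReal.ofReal (φ z) = ENNReal.ofReal (max (φ z) 0) := by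
    intro z
    rcases le_total (φ z) 0 with hz | hz
    · rw [max_eq_right hz, ENNReal.ofReal_of_nonpos hz, ENNReal.ofReal_zero]
    · rw [max_eq_left hz]
  simp_rw [e]
  rw [lintegral_eq_lintegral_meas_lt (f := fun z => max (φ z) 0) μ (.of_forall fun z => le_max_right _ _)
      hmono.measurable.aemeasurable,
    lintegral_eq_lintegral_meas_lt (f := fun z => max (φ z) 0) ν (.of_forall fun z => le_max_right _ _)
      hmono.measurable.aemeasurable]
  refine lintegral_mono fun t => ?_
  have hms : MeasurableSet {a : ↥S | t < max (φ a) 0} := measurableSet_lt measurable_const hmono.measurable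
  have hc := h {a : ↥S | t < max (φ a) 0}ᶜ (by
    intro a b hab ha hb
    exact ha (lt_of_lt_of_le hb (hmono hab)))
  rw [prob_compl_eq_one_sub hms, prob_compl_eq_one_sub hms] at hc
  exact (ENNReal.sub_le_sub_iff_left prob_le_one ENNReal.one_ne_top).mp hc

lemma aux_mono_integral {S : Set ℝ} (μ ν : Measure ↥S) [IsProbabilityMeasure μ]
    [IsProbabilityMeasure ν]
    (h : ∀ U : Set ↥S, IsUpperSet U → μ U ≤ ν U) (φ : ↥S → ℝ) (hφ : Monotone φ)
    (h1 : Integrable φ μ) (h2 : Integrable φ ν) :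
    ∫ z, φ z ∂μ ≤ ∫ z, φ z ∂ν := by
  rw [integral_eq_lintegral_pos_part_sub_lintegral_neg_part h1,
    integral_eq_lintegral_pos_part_sub_lintegral_neg_part h2]
  have a := ENNReal.toReal_mono h2.lintegral_lt_top.ne (aux_mono_lintegral μ ν h φ hφ)
  have b := ENNReal.toReal_mono h1.neg.lintegral_lt_top.ne
    (aux_anti_lintegral μ ν h (-φ) hφ.neg)
  simp only [Pi.neg_apply] at b
  linarith

/-- If the negative parts of `H n` are controlled by those of `h`, then the positive part of the
limit is integrable. -/
lemma aux_pos {α : Type*} [MeasurableSpace α] (ν : Measure α) (H : ℕ → α → ℝ) (h : α → ℝ)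
    (hH : ∀ n, Integrable (H n) ν) (hm : ∀ n, Measurable (H n))
    (hlim : ∀ y, Tendsto (fun n => H n y) atTop (𝓝 (h y)))
    (B : ℝ) (hB : ∀ n, ∫ y, H n y ∂ν ≤ B)
    (hneg : ∀ n y, ENNReal.ofReal (-H n y) ≤ ENNReal.ofReal (-h y))
    (hfin : ∫⁻ y, ENNReal.ofReal (-h y) ∂ν ≠ ∞) :
    ∫⁻ y, ENNReal.ofReal (h y) ∂ν ≠ ∞ := by
  set N := (∫⁻ y, ENNReal.ofReal (-h y) ∂ν).toReal
  have hbd : ∀ n, ∫⁻ y, ENNReal.ofReal (H n y) ∂ν ≤ ENNReal.ofReal (B + N) := by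
    intro n
    have e := integral_eq_lintegral_pos_part_sub_lintegral_neg_part (hH n)
    have h1 := ENNReal.toReal_mono hfin (lintegral_mono (μ := ν) (hneg n))
    rw [← ENNReal.ofReal_toReal (hH n).lintegral_lt_top.ne]
    apply ENNReal.ofReal_le_ofReal
    have := hB n
    linarith
  have hl : ∀ y, ENNReal.ofReal (h y) = liminf (fun n => ENNReal.ofReal (H n y)) atTop := fun y =>
    ((ENNReal.continuous_ofReal.tendsto _).comp (hlim y)).liminf_eq.symm
  simp_rw [hl]
  refine ne_top_of_le_ne_top (ENNReal.ofReal_ne_top (r := B + N))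
    ((lintegral_liminf_le fun n => (hm n).ennreal_ofReal).trans ?_)
  exact liminf_le_of_frequently_le' (Frequently.of_forall hbd)

/-- Accumulated reward until return to `C`. -/
noncomputable def auxV {α : Type*} [MeasurableSpace α] (K : Kernel α α) (C : Set α)
    (u : α → ℝ≥0∞) : ℕ → α → ℝ≥0∞
  | 0 => 0
  | n + 1 => fun y => u y + ∫⁻ z in Cᶜ, auxV K C u n z ∂(K y)

lemma auxV_meas {α : Type*} [MeasurableSpace α] (K : Kernel α α) [IsMarkovKernel K] (C : Set α)
    (hC : MeasurableSet C) (u : α → ℝ≥0∞) (hu : Measurable u) (n : ℕ) :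
    Measurable (auxV K C u n) := by
  induction n with
  | zero => exact measurable_const
  | succ n ih =>
    refine hu.add ?_
    simp_rw [← lintegral_indicator hC.compl]
    exact (ih.indicator hC.compl).lintegral_kernel

lemma auxV_mono {α : Type*} [MeasurableSpace α] (K : Kernel α α) (C : Set α)
    (u : α → ℝ≥0∞) (n : ℕ) (y : α) :
    auxV K C u n y ≤ auxV K C u (n + 1) y := by
  induction n generalizing y with
  | zero => exact zero_le
  | succ n ih => exact add_le_add le_rfl (lintegral_mono ih)

lemma auxV_int {α : Type*} [MeasurableSpace α] (K : Kernel α α) [IsMarkovKernel K] (C : Set α)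
    (hC : MeasurableSet C) (u : α → ℝ≥0∞) (hu : Measurable u)
    (π : Measure α) (hstat : π.bind (fun x => K x) = π) (n : ℕ) :
    ∫⁻ y, auxV K C u (n + 1) y ∂π = ∫⁻ y, u y ∂π + ∫⁻ y in Cᶜ, auxV K C u n y ∂π := by
  have hV := auxV_meas K C hC u hu n
  simp only [auxV]
  rw [lintegral_add_left hu]
  congr 1
  simp_rw [← lintegral_indicator hC.compl]
  conv_rhs => rw [← hstat]
  rw [Measure.lintegral_bind K.measurable.aemeasurable (hV.indicator hC.compl).aemeasurable]

lemma auxV_kac {α : Type*} [MeasurableSpace α] (K : Kernel α α) [IsMarkovKernel K] (C : Set α)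
    (hC : MeasurableSet C) (u : α → ℝ≥0∞) (hu : Measurable u)
    (π : Measure α) (hstat : π.bind (fun x => K x) = π) (hfin : ∫⁻ y, u y ∂π ≠ ∞) (n : ℕ) :
    ∫⁻ y in C, auxV K C u n y ∂π ≤ ∫⁻ y, u y ∂π := by
  have htop : ∀ n, ∫⁻ y, auxV K C u n y ∂π ≠ ∞ := by
    intro n
    induction n with
    | zero => simp [auxV]
    | succ n ih =>
      rw [auxV_int K C hC u hu π hstat]
      exact ENNReal.add_ne_top.mpr
        ⟨hfin, ne_top_of_le_ne_top ih (setLIntegral_le_lintegral _ _)⟩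
  have h1 := auxV_int K C hC u hu π hstat n
  rw [← lintegral_add_compl _ hC] at h1
  have h2 : ∫⁻ y in Cᶜ, auxV K C u n y ∂π ≤ ∫⁻ y in Cᶜ, auxV K C u (n + 1) y ∂π :=
    lintegral_mono fun y => auxV_mono K C u n y
  have h3 : ∫⁻ y in Cᶜ, auxV K C u (n + 1) y ∂π ≠ ∞ :=
    ne_top_of_le_ne_top (htop (n + 1)) (setLIntegral_le_lintegral _ _)
  have h4 : ∫⁻ y in C, auxV K C u (n + 1) y ∂π ≤ ∫⁻ y, u y ∂π := by
    refine (ENNReal.add_le_add_iff_right h3).mp ?_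
    rw [h1]
    exact add_le_add le_rfl h2
  exact (lintegral_mono fun y => auxV_mono K C u n y).trans h4

/-- Some starting point has integrable one-step potential. -/
lemma aux_exists {α : Type*} [MeasurableSpace α] (K : Kernel α α) [IsMarkovKernel K]
    (π : Measure α) [IsProbabilityMeasure π] (hstat : π.bind (fun x => K x) = π)
    (rc : α → ℝ) (hrc : Measurable rc) (hint : Integrable rc π)
    (G : ℕ → α → ℝ) (g : α → ℝ) (hG : ∀ n, Measurable (G n)) (hG0 : ∀ y, G 0 y = 0)
    (hrec : ∀ n y, G (n + 1) y = rc y + ∫ z, G n z ∂(K y))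
    (hlim : ∀ y, Tendsto (fun n => G n y) atTop (𝓝 (g y))) :
    ∃ x, Integrable g (K x) := by
  have hgm : Measurable g := measurable_of_tendsto_metrizable hG (tendsto_pi_nhds.mpr hlim)
  set u : α → ℝ≥0∞ := fun y => ‖rc y‖ₑ
  have hu : Measurable u := hrc.enorm
  have hufin : ∫⁻ y, u y ∂π ≠ ∞ := hint.2.ne
  let Cs : ℕ → Set α := fun M => {y | ∀ n, ‖G n y‖ₑ ≤ (M : ℝ≥0∞)}
  have hCs : ∀ M, MeasurableSet (Cs M) := fun M => by
    have : Cs M = ⋂ n, {y | ‖G n y‖ₑ ≤ (M : ℝ≥0∞)} := by ext; simp [Cs]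
    rw [this]
    exact MeasurableSet.iInter fun n => measurableSet_le (hG n).enorm measurable_const
  have hcov : ⋃ M, Cs M = univ := by
    ext y
    simp only [mem_iUnion, mem_univ, iff_true]
    obtain ⟨B, hB⟩ := (hlim y).norm.bddAbove_range
    obtain ⟨M, hM⟩ := exists_nat_ge B
    refine ⟨M, fun n => ?_⟩
    have : ‖G n y‖ ≤ M := (hB (mem_range_self n)).trans hM
    rw [← ofReal_norm, ← ENNReal.ofReal_natCast]
    exact ENNReal.ofReal_le_ofReal this
  obtain ⟨M, hM⟩ : ∃ M, π (Cs M) ≠ 0 := by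
    by_contra hcon
    push Not at hcon
    have := measure_iUnion_null hcon
    rw [hcov] at this
    simp at this
  set C := Cs M
  have hC : MeasurableSet C := hCs M
  have hkey : ∀ n y, ‖G n y‖ₑ ≤ M + auxV K C u n y := by
    intro n
    induction n with
    | zero => intro y; simp [hG0]
    | succ n ih =>
      intro y
      rw [hrec]
      have e1 : ‖∫ z, G n z ∂(K y)‖ₑ ≤ ∫⁻ z, ‖G n z‖ₑ ∂(K y) := enorm_integral_le_lintegral_enorm _
      have e2 : ∫⁻ z, ‖G n z‖ₑ ∂(K y) ≤ M + ∫⁻ z in Cᶜ, auxV K C u n z ∂(K y) := by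
        calc ∫⁻ z, ‖G n z‖ₑ ∂(K y) ≤ ∫⁻ z, (M + Cᶜ.indicator (auxV K C u n) z) ∂(K y) := by
              refine lintegral_mono fun z => ?_
              by_cases hz : z ∈ C
              · exact (hz n).trans le_self_add
              · rw [indicator_of_mem (by exact hz)]; exact ih z
          _ = _ := by
              rw [lintegral_add_left measurable_const, lintegral_indicator hC.compl]; simp
      calc ‖rc y + ∫ z, G n z ∂(K y)‖ₑ ≤ u y + (M + ∫⁻ z in Cᶜ, auxV K C u n z ∂(K y)) :=
            (enorm_add_le _ _).trans (add_le_add le_rfl (e1.trans e2))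
        _ = M + auxV K C u (n + 1) y := by simp only [auxV]; ring
  have hVm := auxV_meas K C hC u hu
  have hsup : ∫⁻ y in C, (⨆ n, auxV K C u n y) ∂π ≤ ∫⁻ y, u y ∂π := by
    rw [lintegral_iSup hVm (monotone_nat_of_le_succ fun n y => auxV_mono K C u n y)]
    exact iSup_le fun n => auxV_kac K C hC u hu π hstat hufin n
  have hae := ae_lt_top (Measurable.iSup hVm) (ne_top_of_le_ne_top hufin hsup)
  have : NeZero (π.restrict C) := ⟨by simpa [Measure.restrict_eq_zero] using hM⟩
  obtain ⟨x, hx⟩ := hae.exists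
  refine ⟨x, hgm.aestronglyMeasurable, ?_⟩
  have hb : ∀ n, ∫⁻ z, ‖G n z‖ₑ ∂(K x) ≤ M + ⨆ n, auxV K C u n x := by
    intro n
    calc ∫⁻ z, ‖G n z‖ₑ ∂(K x) ≤ ∫⁻ z, (M + Cᶜ.indicator (auxV K C u n) z) ∂(K x) := by
              refine lintegral_mono fun z => ?_
              by_cases hz : z ∈ C
              · exact (hz n).trans le_self_add
              · rw [indicator_of_mem (by exact hz)]; exact hkey n z
      _ = M + ∫⁻ z in Cᶜ, auxV K C u n z ∂(K x) := by
              rw [lintegral_add_left measurable_const, lintegral_indicator hC.compl]; simp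
      _ ≤ M + auxV K C u (n + 1) x := add_le_add le_rfl (by simp only [auxV]; exact le_add_self)
      _ ≤ _ := add_le_add le_rfl (le_iSup (fun n => auxV K C u n x) (n + 1))
  have hl : ∀ y, ‖g y‖ₑ = liminf (fun n => ‖G n y‖ₑ) atTop := fun y =>
    ((continuous_enorm.tendsto _).comp (hlim y)).liminf_eq.symm
  unfold HasFiniteIntegral
  simp_rw [hl]
  refine lt_of_le_of_lt ((lintegral_liminf_le fun n => (hG n).enorm).trans
    (liminf_le_of_frequently_le' (Frequently.of_forall hb))) ?_
  exact ENNReal.add_lt_top.mpr ⟨ENNReal.natCast_lt_top M, hx⟩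

/-- Iterates of a kernel. -/
noncomputable def auxP {α : Type*} [MeasurableSpace α] (K : Kernel α α) : ℕ → Kernel α α
  | 0 => Kernel.id
  | n + 1 => K ∘ₖ auxP K n

lemma auxP_succ {α : Type*} [MeasurableSpace α] (K : Kernel α α) (n : ℕ) :
    auxP K (n + 1) = auxP K n ∘ₖ K := by
  induction n with
  | zero => simp [auxP, Kernel.comp_id, Kernel.id_comp]
  | succ n ih =>
    change K ∘ₖ auxP K (n + 1) = (K ∘ₖ auxP K n) ∘ₖ K
    rw [ih, Kernel.comp_assoc]

instance auxP_markov {α : Type*} [MeasurableSpace α] (K : Kernel α α) [IsMarkovKernel K] (n : ℕ) :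
    IsMarkovKernel (auxP K n) := by
  induction n with
  | zero => unfold auxP; infer_instance
  | succ n ih => unfold auxP; infer_instance

theorem stmt_4 {S : Set ℝ} (K : Kernel ↥S ↥S) [IsMarkovKernel K]
    (hmono : ∀ y : ↥S, Monotone (fun x : ↥S => K x {z : ↥S | y < z}))
    (π : Measure ↥S) [IsProbabilityMeasure π]
    (hstat : π.bind (fun x => K x) = π)
    (μ : ↥S → ℕ → Measure ↥S)
    (hμ0 : ∀ x, μ x 0 = Measure.dirac x)
    (hμrec : ∀ x j, μ x (j + 1) = (μ x j).bind (fun z => K z))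
    (r : ↥S → ℝ) (hr : Monotone r) (hrint : Integrable r π)
    (hrj : ∀ x j, Integrable r (μ x j))
    (hsum : ∀ x : ↥S, Summable (fun j : ℕ => |∫ z, (r z - ∫ w, r w ∂π) ∂(μ x j)|)) :
    Monotone (fun x : ↥S => ∑' j : ℕ, ∫ z, (r z - ∫ w, r w ∂π) ∂(μ x j)) ∧
    ∀ x : ↥S,
      (∫ y, (∑' j : ℕ, ∫ z, (r z - ∫ w, r w ∂π) ∂(μ y j)) ∂(K x))
        - (∑' j : ℕ, ∫ z, (r z - ∫ w, r w ∂π) ∂(μ x j))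
      = -(r x - ∫ w, r w ∂π) := by
  have hup : ∀ x y : ↥S, x ≤ y → ∀ U : Set ↥S, IsUpperSet U → K x U ≤ K y U := fun x y hxy U hU =>
    aux_upper (K x) (K y) (fun z => hmono z hxy) U hU
  have hμ : ∀ x j, μ x j = auxP K j x := by
    intro x j
    induction j with
    | zero => rw [hμ0]; simp [auxP, Kernel.id_apply]
    | succ j ih => rw [hμrec, ih]; simp only [auxP]; rw [Kernel.comp_apply]
  set c := ∫ w, r w ∂π
  set rc : ↥S → ℝ := fun z => r z - c
  have hrcm : Monotone rc := fun a b hab => sub_le_sub_right (hr hab) c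
  set f : ℕ → ↥S → ℝ := fun j x => ∫ z, rc z ∂(μ x j) with hf
  have hrci : ∀ x j, Integrable rc (auxP K j x) := fun x j => by
    have := hrj x j
    rw [hμ] at this
    exact this.sub (integrable_const c)
  have hf0 : ∀ x, f 0 x = rc x := fun x => by
    simp only [hf, hμ0]
    exact integral_dirac' _ _ hrcm.measurable.stronglyMeasurable
  have hfi : ∀ j x, Integrable (f j) (K x) := fun j x => by
    have := hrci x (j + 1)
    rw [auxP_succ] at this
    simpa only [hf, hμ] using this.integral_comp
  have hfs : ∀ j x, f (j + 1) x = ∫ y, f j y ∂(K x) := fun j x => by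
    have := hrci x (j + 1)
    rw [auxP_succ] at this
    have := Kernel.integral_comp this
    simpa only [hf, hμ, auxP_succ] using this
  have hfm : ∀ j, Monotone (f j) := by
    intro j
    induction j with
    | zero => intro x y hxy; rw [hf0, hf0]; exact hrcm hxy
    | succ j ih =>
      intro x y hxy
      rw [hfs, hfs]
      exact aux_mono_integral _ _ (hup x y hxy) _ ih (hfi j x) (hfi j y)
  have hs : ∀ x, Summable (fun j => f j x) := fun x => (hsum x).of_abs
  set g : ↥S → ℝ := fun x => ∑' j, f j x with hg
  have hgm : Monotone g := fun x y hxy => (hs x).tsum_le_tsum (fun j => hfm j hxy) (hs y)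
  refine ⟨hgm, fun x => ?_⟩
  change (∫ y, g y ∂(K x)) - g x = - rc x
  set G : ℕ → ↥S → ℝ := fun n y => ∑ j ∈ Finset.range n, f j y with hGdef
  have hGm : ∀ n, Monotone (G n) := fun n x y hxy => Finset.sum_le_sum fun j _ => hfm j hxy
  have hlim : ∀ y, Tendsto (fun n => G n y) atTop (𝓝 (g y)) := fun y =>
    (hs y).hasSum.tendsto_sum_nat
  have hGi : ∀ n x, Integrable (G n) (K x) := fun n x =>
    integrable_finsetSum _ fun j _ => hfi j x
  have hrec : ∀ n y, G (n + 1) y = rc y + ∫ z, G n z ∂(K y) := by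
    intro n y
    simp only [hGdef]
    rw [integral_finsetSum _ fun j _ => hfi j y, Finset.sum_range_succ', hf0, add_comm]
    simp_rw [hfs]
  obtain ⟨x0, hx0⟩ := aux_exists K π hstat rc hrcm.measurable (hrint.sub (integrable_const c)) G g
    (fun n => (hGm n).measurable) (fun y => by simp [hGdef]) hrec hlim
  have hKlim : Tendsto (fun n => ∫ z, G n z ∂(K x)) atTop (𝓝 (g x - rc x)) := by
    have h1 := ((hlim x).comp (tendsto_add_atTop_nat 1)).sub_const (rc x)
    refine h1.congr fun n => ?_
    simp only [Function.comp_apply]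
    rw [hrec]; ring
  -- recentering
  set H : ℕ → ↥S → ℝ := fun n y => G n y - G n x0 with hH
  set h : ↥S → ℝ := fun y => g y - g x0 with hh
  have hHm : ∀ n, Monotone (H n) := fun n a b hab => sub_le_sub_right (hGm n hab) _
  have hhm : Monotone h := fun a b hab => sub_le_sub_right (hgm hab) _
  have hHi : ∀ n, Integrable (H n) (K x) := fun n => (hGi n x).sub (integrable_const _)
  have hHlim : ∀ y, Tendsto (fun n => H n y) atTop (𝓝 (h y)) := fun y => (hlim y).sub (hlim x0)
  have hHint : ∀ n, ∫ z, H n z ∂(K x) = ∫ z, G n z ∂(K x) - G n x0 := fun n => by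
    simp only [hH]
    rw [integral_sub (hGi n x) (integrable_const _)]; simp
  have hHIlim : Tendsto (fun n => ∫ z, H n z ∂(K x)) atTop (𝓝 (g x - rc x - g x0)) := by
    simp_rw [hHint]; exact hKlim.sub (hlim x0)
  have hge : ∀ n y, x0 ≤ y → 0 ≤ H n y ∧ H n y ≤ h y := by
    intro n y hy
    refine ⟨sub_nonneg.mpr (hGm n hy), ?_⟩
    have hmn : Monotone (fun n => H n y) := monotone_nat_of_le_succ fun n => by
      simp only [hH, hGdef, Finset.sum_range_succ]
      have := hfm n hy
      linarith
    exact hmn.ge_of_tendsto (hHlim y) n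
  have hle : ∀ n y, y ≤ x0 → H n y ≤ 0 ∧ h y ≤ H n y := by
    intro n y hy
    refine ⟨sub_nonpos.mpr (hGm n hy), ?_⟩
    have hmn : Antitone (fun n => H n y) := antitone_nat_of_succ_le fun n => by
      simp only [hH, hGdef, Finset.sum_range_succ]
      have := hfm n hy
      linarith
    exact hmn.le_of_tendsto (hHlim y) n
  have hpos : ∀ n y, ENNReal.ofReal (H n y) ≤ ENNReal.ofReal (h y) := by
    intro n y
    rcases le_total x0 y with hy | hy
    · exact ENNReal.ofReal_le_ofReal (hge n y hy).2
    · rw [ENNReal.ofReal_of_nonpos (hle n y hy).1]; exact zero_le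
  have hneg : ∀ n y, ENNReal.ofReal (-H n y) ≤ ENNReal.ofReal (-h y) := by
    intro n y
    rcases le_total x0 y with hy | hy
    · rw [ENNReal.ofReal_of_nonpos (neg_nonpos.mpr (hge n y hy).1)]; exact zero_le
    · exact ENNReal.ofReal_le_ofReal (neg_le_neg (hle n y hy).2)
  have habs : ∀ n y, ‖H n y‖ ≤ ‖h y‖ := by
    intro n y
    rw [Real.norm_eq_abs, Real.norm_eq_abs]
    rcases le_total x0 y with hy | hy
    · have := hge n y hy
      rw [abs_of_nonneg this.1]; exact this.2.trans (le_abs_self _)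
    · have := hle n y hy
      rw [abs_of_nonpos this.1]; exact (neg_le_neg this.2).trans (neg_le_abs _)
  have hh0 : Integrable h (K x0) := hx0.sub (integrable_const _)
  have hfinal : ∫⁻ y, ENNReal.ofReal (h y) ∂(K x) ≠ ∞ ∧ ∫⁻ y, ENNReal.ofReal (-h y) ∂(K x) ≠ ∞ := by
    rcases le_total x0 x with hx | hx
    · have hn : ∫⁻ y, ENNReal.ofReal (-h y) ∂(K x) ≠ ∞ :=
        ne_top_of_le_ne_top hh0.neg.lintegral_lt_top.ne
          (aux_anti_lintegral _ _ (hup x0 x hx) (-h) hhm.neg)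
      obtain ⟨B, hB⟩ := hHIlim.bddAbove_range
      exact ⟨aux_pos (K x) H h hHi (fun n => (hHm n).measurable) hHlim B
        (fun n => hB (mem_range_self n)) hneg hn, hn⟩
    · have hp : ∫⁻ y, ENNReal.ofReal (h y) ∂(K x) ≠ ∞ :=
        ne_top_of_le_ne_top hh0.lintegral_lt_top.ne
          (aux_mono_lintegral _ _ (hup x x0 hx) h hhm)
      obtain ⟨B, hB⟩ := hHIlim.neg.bddAbove_range
      refine ⟨hp, aux_pos (K x) (fun n y => -H n y) (fun y => -h y) (fun n => (hHi n).neg)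
        (fun n => (hHm n).measurable.neg) (fun y => (hHlim y).neg) B (fun n => ?_) ?_ ?_⟩
      · rw [integral_neg]; exact hB (mem_range_self n)
      · simpa using hpos
      · simpa using hp
  have hhi : Integrable h (K x) := by
    refine ⟨hhm.measurable.aestronglyMeasurable, ?_⟩
    unfold HasFiniteIntegral
    have e : ∀ y, ‖h y‖ₑ ≤ ENNReal.ofReal (h y) + ENNReal.ofReal (-h y) := fun y => by
      rw [← ofReal_norm, Real.norm_eq_abs]
      rcases le_total 0 (h y) with hy | hy
      · rw [abs_of_nonneg hy]; exact le_self_add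
      · rw [abs_of_nonpos hy]; exact le_add_self
    refine lt_of_le_of_lt (lintegral_mono e) ?_
    rw [lintegral_add_left hhm.measurable.ennreal_ofReal]
    exact ENNReal.add_lt_top.mpr ⟨hfinal.1.lt_top, hfinal.2.lt_top⟩
  have hdct : Tendsto (fun n => ∫ z, H n z ∂(K x)) atTop (𝓝 (∫ z, h z ∂(K x))) :=
    tendsto_integral_of_dominated_convergence (fun y => ‖h y‖)
      (fun n => (hHi n).aestronglyMeasurable) hhi.norm
      (fun n => .of_forall fun y => habs n y) (.of_forall hHlim)
  have heq := tendsto_nhds_unique hdct hHIlim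
  have hgi : Integrable g (K x) := by
    have := hhi.add (integrable_const (g x0))
    refine this.congr (.of_forall fun y => ?_)
    simp [hh]
  have : ∫ z, h z ∂(K x) = ∫ z, g z ∂(K x) - g x0 := by
    simp only [hh]
    rw [integral_sub hgi (integrable_const _)]; simp
  linarith
end

section
/- Let X be an irreducible positive recurrent stochastically monotone Markov chain on ℤ₊ with stationary distribution π, and r : ℤ₊ → ℝ a π-integrable non-decreasing function. Then g₀(x) = E_x Σ_{j=0}^{τ−1} r_c(X_j), with τ = inf{n ≥ 1 : X_n = 0} and r_c = r − πr, is a non-decreasing solution of Poisson's equation (P−I)g₀ = −r_c. -/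
open MeasureTheory Set ProbabilityTheory Filter

open scoped ENNReal Topology

noncomputable def Pop (μ : ℕ → Measure ℕ) (f : ℕ → ℝ≥0∞) (x : ℕ) : ℝ≥0∞ := ∫⁻ y, f y ∂μ x

noncomputable def Rop (f : ℕ → ℝ≥0∞) (y : ℕ) : ℝ≥0∞ := if y = 0 then 0 else f y

noncomputable def Qop (μ : ℕ → Measure ℕ) (f : ℕ → ℝ≥0∞) : ℕ → ℝ≥0∞ := Pop μ (Rop f)

lemma Rop_le (f : ℕ → ℝ≥0∞) : Rop f ≤ f := by
  intro y; unfold Rop; split_ifs <;> simp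

lemma Pop_mono (μ : ℕ → Measure ℕ) {f g : ℕ → ℝ≥0∞} (h : f ≤ g) : Pop μ f ≤ Pop μ g :=
  fun _ => lintegral_mono h

lemma Rop_mono {f g : ℕ → ℝ≥0∞} (h : f ≤ g) : Rop f ≤ Rop g := by
  intro y; unfold Rop; split_ifs
  · simp
  · exact h y

lemma Qop_mono (μ : ℕ → Measure ℕ) : Monotone (Qop μ) :=
  fun _ _ h => Pop_mono μ (Rop_mono h)

lemma Pop_mono' (μ : ℕ → Measure ℕ) : Monotone (Pop μ) := fun _ _ h => Pop_mono μ h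

lemma Qop_le_Pop (μ : ℕ → Measure ℕ) (f : ℕ → ℝ≥0∞) : Qop μ f ≤ Pop μ f :=
  Pop_mono μ (Rop_le f)

lemma Qit_mono (μ : ℕ → Measure ℕ) (n : ℕ) {f g : ℕ → ℝ≥0∞} (h : f ≤ g) :
    (Qop μ)^[n] f ≤ (Qop μ)^[n] g := (Qop_mono μ).iterate n h

lemma Qit_le_Pit (μ : ℕ → Measure ℕ) (n : ℕ) (f : ℕ → ℝ≥0∞) :
    (Qop μ)^[n] f ≤ (Pop μ)^[n] f := by
  induction n with
  | zero => simp
  | succ n ih =>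
    rw [Function.iterate_succ_apply', Function.iterate_succ_apply']
    exact (Qop_le_Pop μ _).trans (Pop_mono μ ih)

lemma Pop_add (μ : ℕ → Measure ℕ) (f g : ℕ → ℝ≥0∞) : Pop μ (f + g) = Pop μ f + Pop μ g := by
  funext x
  exact lintegral_add_left (measurable_of_countable f) g

lemma Pop_smul (μ : ℕ → Measure ℕ) (c : ℝ≥0∞) (f : ℕ → ℝ≥0∞) :
    Pop μ (c • f) = c • Pop μ f := by
  funext x
  exact lintegral_const_mul c (measurable_of_countable f)

lemma Pop_tsum (μ : ℕ → Measure ℕ) (f : ℕ → ℕ → ℝ≥0∞) :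
    Pop μ (fun x => ∑' n, f n x) = fun x => ∑' n, Pop μ (f n) x := by
  funext x
  exact lintegral_tsum (fun n => (measurable_of_countable (f n)).aemeasurable)

lemma Rop_add (f g : ℕ → ℝ≥0∞) : Rop (f + g) = Rop f + Rop g := by
  funext x; simp only [Rop, Pi.add_apply]; split_ifs <;> simp

lemma Rop_smul (c : ℝ≥0∞) (f : ℕ → ℝ≥0∞) : Rop (c • f) = c • Rop f := by
  funext x; simp only [Rop, Pi.smul_apply]; split_ifs <;> simp

lemma Rop_tsum (f : ℕ → ℕ → ℝ≥0∞) :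
    Rop (fun x => ∑' n, f n x) = fun x => ∑' n, Rop (f n) x := by
  funext x; simp only [Rop]; split_ifs <;> simp

lemma Qop_add (μ : ℕ → Measure ℕ) (f g : ℕ → ℝ≥0∞) : Qop μ (f + g) = Qop μ f + Qop μ g := by
  simp only [Qop, Rop_add, Pop_add]

lemma Qop_smul (μ : ℕ → Measure ℕ) (c : ℝ≥0∞) (f : ℕ → ℝ≥0∞) :
    Qop μ (c • f) = c • Qop μ f := by
  simp only [Qop, Rop_smul, Pop_smul]

lemma Qop_tsum (μ : ℕ → Measure ℕ) (f : ℕ → ℕ → ℝ≥0∞) :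
    Qop μ (fun x => ∑' n, f n x) = fun x => ∑' n, Qop μ (f n) x := by
  simp only [Qop, Rop_tsum, Pop_tsum]

lemma Qit_add (μ : ℕ → Measure ℕ) (n : ℕ) (f g : ℕ → ℝ≥0∞) :
    (Qop μ)^[n] (f + g) = (Qop μ)^[n] f + (Qop μ)^[n] g := by
  induction n with
  | zero => simp
  | succ n ih => simp only [Function.iterate_succ_apply', ih, Qop_add]

lemma Qit_smul (μ : ℕ → Measure ℕ) (n : ℕ) (c : ℝ≥0∞) (f : ℕ → ℝ≥0∞) :
    (Qop μ)^[n] (c • f) = c • (Qop μ)^[n] f := by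
  induction n with
  | zero => simp
  | succ n ih => simp only [Function.iterate_succ_apply', ih, Qop_smul]

lemma Pit_tsum (μ : ℕ → Measure ℕ) (n : ℕ) (f : ℕ → ℕ → ℝ≥0∞) :
    (Pop μ)^[n] (fun x => ∑' k, f k x) = fun x => ∑' k, (Pop μ)^[n] (f k) x := by
  induction n with
  | zero => simp
  | succ n ih => simp only [Function.iterate_succ_apply', ih, Pop_tsum]

lemma Pit_smul (μ : ℕ → Measure ℕ) (n : ℕ) (c : ℝ≥0∞) (f : ℕ → ℝ≥0∞) :
    (Pop μ)^[n] (c • f) = c • (Pop μ)^[n] f := by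
  induction n with
  | zero => simp
  | succ n ih => simp only [Function.iterate_succ_apply', ih, Pop_smul]

/-- layer cake: `P` preserves monotone functions. -/
lemma Pop_monotone (μ : ℕ → Measure ℕ) (hp : ∀ x, IsProbabilityMeasure (μ x))
    (hmono : ∀ y : ℕ, Monotone (fun x => μ x (Ioi y))) {f : ℕ → ℝ≥0∞} (hf : Monotone f) :
    Monotone (Pop μ f) := by
  have hrep : f = fun y => f 0 + ∑' k, (f (k+1) - f k) * (Ioi k).indicator 1 y := by
    funext y
    have h1 : ∑' k, (f (k+1) - f k) * (Ioi k).indicator 1 y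
        = ∑ k ∈ Finset.range y, (f (k+1) - f k) := by
      rw [tsum_eq_sum (s := Finset.range y)]
      · refine Finset.sum_congr rfl fun k hk => ?_
        simp [Finset.mem_range.1 hk, Set.indicator]
      · intro k hk
        have : ¬ k < y := by simpa using hk
        simp [this]
    rw [h1]
    clear h1
    induction y with
    | zero => simp
    | succ y ih =>
      rw [Finset.sum_range_succ, ← add_assoc, ← ih]
      exact (add_tsub_cancel_of_le (hf (Nat.le_succ y))).symm
  have hP : ∀ x, Pop μ f x = f 0 + ∑' k, (f (k+1) - f k) * μ x (Ioi k) := by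
    intro x
    unfold Pop
    conv_lhs => rw [hrep]
    rw [lintegral_add_left measurable_const, lintegral_const, measure_univ, mul_one,
      lintegral_tsum (fun n => (measurable_of_countable _).aemeasurable)]
    congr 2
    funext k
    rw [lintegral_const_mul _ (measurable_of_countable _), lintegral_indicator_one measurableSet_Ioi]
  intro x y hxy
  rw [hP, hP]
  refine add_le_add le_rfl (ENNReal.tsum_le_tsum fun k => ?_)
  exact mul_le_mul_right (hmono k hxy) _

section stat
variable (μ : ℕ → Measure ℕ) (π : Measure ℕ)

lemma stat_P (hstat : π.bind μ = π) (f : ℕ → ℝ≥0∞) : ∫⁻ x, Pop μ f x ∂π = ∫⁻ x, f x ∂π := by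
  conv_rhs => rw [← hstat]
  rw [Measure.lintegral_bind (measurable_from_top).aemeasurable (measurable_of_countable _).aemeasurable]
  rfl

lemma stat_Pit (hstat : π.bind μ = π) (n : ℕ) (f : ℕ → ℝ≥0∞) :
    ∫⁻ x, (Pop μ)^[n] f x ∂π = ∫⁻ x, f x ∂π := by
  induction n with
  | zero => simp
  | succ n ih => rw [Function.iterate_succ_apply', stat_P μ π hstat, ih]

lemma mul_le_lint (f : ℕ → ℝ≥0∞) (x : ℕ) : π {x} * f x ≤ ∫⁻ x, f x ∂π := by
  rw [lintegral_countable']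
  rw [mul_comm]
  exact ENNReal.le_tsum (f := fun a => f a * π {a}) x

lemma split_zero (f : ℕ → ℝ≥0∞) : ∫⁻ x, f x ∂π = π {0} * f 0 + ∫⁻ x, Rop f x ∂π := by
  rw [lintegral_countable', lintegral_countable', tsum_eq_zero_add' ENNReal.summable,
    tsum_eq_zero_add' (f := fun a => Rop f a * π {a}) ENNReal.summable]
  simp [Rop, mul_comm]

lemma stat_Q (hstat : π.bind μ = π) (f : ℕ → ℝ≥0∞) (N : ℕ) :
    ∫⁻ x, f x ∂π = π {0} * ∑ n ∈ Finset.range N, (Qop μ)^[n] f 0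
      + ∫⁻ x, (Qop μ)^[N] f x ∂π := by
  induction N with
  | zero => simp
  | succ N ih =>
    rw [ih, Finset.sum_range_succ, mul_add, add_assoc, split_zero π ((Qop μ)^[N] f),
      ← stat_P μ π hstat (Rop _), Function.iterate_succ_apply']
    rfl

variable [IsProbabilityMeasure π]

lemma Qit_one_le (hp : ∀ x, IsProbabilityMeasure (μ x)) (n : ℕ) : (Qop μ)^[n] 1 ≤ 1 := by
  have h : Qop μ 1 ≤ 1 := by
    refine (Qop_le_Pop μ 1).trans ?_
    intro x; simp [Pop]
  induction n with
  | zero => simp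
  | succ n ih => rw [Function.iterate_succ_apply']; exact (Qop_mono μ ih).trans h

lemma stat_bdd (hp : ∀ x, IsProbabilityMeasure (μ x)) (hstat : π.bind μ = π)
    (hT : ∀ x, ∑' n, (Qop μ)^[n] 1 x ≠ ⊤) (f : ℕ → ℝ≥0∞) (C : ℝ≥0∞) (hC : C ≠ ⊤)
    (hf : f ≤ C • (1 : ℕ → ℝ≥0∞)) :
    ∫⁻ x, f x ∂π = π {0} * ∑' n, (Qop μ)^[n] f 0 := by
  have h1 : Tendsto (fun N => ∫⁻ x, (Qop μ)^[N] 1 x ∂π) atTop (𝓝 0) := by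
    have := tendsto_lintegral_of_dominated_convergence (μ := π)
      (F := fun N x => (Qop μ)^[N] 1 x) (f := fun _ => 0) (bound := fun _ => 1)
      (fun n => measurable_of_countable _)
      (fun n => ae_of_all _ fun x => Qit_one_le μ hp n x) (by simp)
      (ae_of_all _ fun x => ENNReal.tendsto_atTop_zero_of_tsum_ne_top (hT x))
    simpa using this
  have h2 : Tendsto (fun N => ∫⁻ x, (Qop μ)^[N] f x ∂π) atTop (𝓝 0) := by
    have h3 : Tendsto (fun N => C * ∫⁻ x, (Qop μ)^[N] 1 x ∂π) atTop (𝓝 0) := by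
      simpa using ENNReal.Tendsto.const_mul h1 (Or.inr hC)
    refine tendsto_of_tendsto_of_tendsto_of_le_of_le tendsto_const_nhds h3 (fun _ => zero_le) ?_
    intro N
    show ∫⁻ x, (Qop μ)^[N] f x ∂π ≤ C * ∫⁻ x, (Qop μ)^[N] 1 x ∂π
    rw [← lintegral_const_mul _ (measurable_of_countable _)]
    refine lintegral_mono fun x => ?_
    have := Qit_mono μ N hf x
    rwa [Qit_smul] at this
  have h4 : Tendsto (fun N => π {0} * ∑ n ∈ Finset.range N, (Qop μ)^[n] f 0
      + ∫⁻ x, (Qop μ)^[N] f x ∂π) atTop (𝓝 (π {0} * ∑' n, (Qop μ)^[n] f 0 + 0)) := by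
    refine Tendsto.add ?_ h2
    exact ENNReal.Tendsto.const_mul (ENNReal.tendsto_nat_tsum _) (Or.inr (measure_ne_top _ _))
  rw [add_zero] at h4
  refine tendsto_nhds_unique ?_ h4
  simp only [← stat_Q μ π hstat f]
  exact tendsto_const_nhds

lemma stat_all (hp : ∀ x, IsProbabilityMeasure (μ x)) (hstat : π.bind μ = π)
    (hT : ∀ x, ∑' n, (Qop μ)^[n] 1 x ≠ ⊤) (f : ℕ → ℝ≥0∞) (hf : ∀ x, f x ≠ ⊤) :
    ∫⁻ x, f x ∂π = π {0} * ∑' n, (Qop μ)^[n] f 0 := by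
  apply le_antisymm
  · have h1 : Tendsto (fun k : ℕ => ∫⁻ x, min (f x) k ∂π) atTop (𝓝 (∫⁻ x, f x ∂π)) := by
      refine lintegral_tendsto_of_tendsto_of_monotone
        (fun n => (measurable_of_countable _).aemeasurable) ?_ ?_
      · refine ae_of_all _ fun x a b hab => ?_
        dsimp only
        gcongr
      · refine ae_of_all _ fun x => ?_
        obtain ⟨k, hk⟩ := ENNReal.exists_nat_gt (hf x)
        refine tendsto_const_nhds.congr' ?_
        filter_upwards [eventually_ge_atTop k] with n hn
        rw [min_eq_left]
        exact hk.le.trans (by exact_mod_cast hn)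
    refine le_of_tendsto' h1 fun k => ?_
    rw [stat_bdd μ π hp hstat hT (fun x => min (f x) k) k (by simp) (fun x => by simp)]
    gcongr with n
    exact Qit_mono μ n (fun x => min_le_left _ _) 0
  · have : Tendsto (fun N => π {0} * ∑ n ∈ Finset.range N, (Qop μ)^[n] f 0) atTop
        (𝓝 (π {0} * ∑' n, (Qop μ)^[n] f 0)) :=
      ENNReal.Tendsto.const_mul (ENNReal.tendsto_nat_tsum _) (Or.inr (measure_ne_top _ _))
    refine le_of_tendsto' this fun N => ?_
    rw [stat_Q μ π hstat f N]
    exact le_self_add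

lemma pi_zero (hp : ∀ x, IsProbabilityMeasure (μ x)) (hstat : π.bind μ = π)
    (hT : ∀ x, ∑' n, (Qop μ)^[n] 1 x ≠ ⊤) : π {0} * ∑' n, (Qop μ)^[n] 1 0 = 1 := by
  rw [← stat_all μ π hp hstat hT 1 (by simp)]
  simp

end stat

lemma disc (μ : ℕ → Measure ℕ) (π : Measure ℕ) [IsProbabilityMeasure π]
    (hp : ∀ x, IsProbabilityMeasure (μ x)) (hstat : π.bind μ = π)
    (hmono : ∀ f : ℕ → ℝ≥0∞, Monotone f → Monotone (Pop μ f))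
    (hpos : ∀ x, π {x} ≠ 0) (s : ℕ → ℝ≥0∞) (hs : Monotone s)
    (hsπ : ∫⁻ x, s x ∂π ≠ ⊤) (α : ℝ≥0∞) (hα : α < 1) :
    ∃ c : ℝ≥0∞, c ≠ ⊤ ∧ ∃ v : ℕ → ℝ≥0∞, Monotone v ∧ v 0 = 0 ∧ (∀ x, v x ≠ ⊤) ∧
      ∀ x, v x + c * ∑' n, α ^ n * (Qop μ)^[n] 1 x = ∑' n, α ^ n * (Qop μ)^[n] s x := by
  have hαt : α ≠ ⊤ := (hα.trans ENNReal.one_lt_top).ne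
  have hgeo : (1 - α)⁻¹ ≠ ⊤ := by
    rw [ENNReal.inv_ne_top]; exact (tsub_pos_of_lt hα).ne'
  set u : ℕ → ℝ≥0∞ := fun x => ∑' n, (α ^ n • (Pop μ)^[n] s) x with hu
  have hbd : ∀ n x, (Pop μ)^[n] s x ≤ (∫⁻ x, s x ∂π) / π {x} := by
    intro n x
    rw [ENNReal.le_div_iff_mul_le (Or.inl (hpos x)) (Or.inl (measure_ne_top _ _)), mul_comm,
      ← stat_Pit μ π hstat n s]
    exact mul_le_lint π _ x
  have hK : ∀ x, (∫⁻ x, s x ∂π) / π {x} ≠ ⊤ := fun x => ENNReal.div_ne_top hsπ (hpos x)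
  have hPu : ∀ N x, (Pop μ)^[N] u x ≤ (1 - α)⁻¹ * ((∫⁻ x, s x ∂π) / π {x}) := by
    intro N x
    rw [hu, Pit_tsum, ← ENNReal.tsum_geometric, ← ENNReal.tsum_mul_right]
    refine ENNReal.tsum_le_tsum fun k => ?_
    rw [Pit_smul, ← Function.iterate_add_apply]
    exact mul_le_mul_right (hbd _ x) _
  have hPu_top : ∀ x, (1 - α)⁻¹ * ((∫⁻ x, s x ∂π) / π {x}) ≠ ⊤ := fun x =>
    ENNReal.mul_ne_top hgeo (hK x)
  have hu_top : ∀ x, u x ≠ ⊤ := fun x => ne_top_of_le_ne_top (hPu_top x) (hPu 0 x)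
  have hPs : ∀ n, Monotone ((Pop μ)^[n] s) := by
    intro n
    induction n with
    | zero => simpa using hs
    | succ n ih => rw [Function.iterate_succ_apply']; exact hmono _ ih
  have hum : Monotone u := by
    intro x y hxy
    refine ENNReal.tsum_le_tsum fun n => ?_
    exact mul_le_mul_right (hPs n hxy) _
  have hu_eq : ∀ x, u x = s x + α * Pop μ u x := by
    intro x
    rw [hu, Pop_tsum, ← ENNReal.tsum_mul_left]
    dsimp only
    rw [tsum_eq_zero_add' (f := fun n => (α ^ n • (Pop μ)^[n] s) x) ENNReal.summable]
    simp only [Pop_smul, pow_zero, Function.iterate_zero, id, one_smul]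
    congr 2
    funext n
    simp only [Pi.smul_apply, smul_eq_mul, Function.iterate_succ_apply']
    ring
  set v : ℕ → ℝ≥0∞ := fun x => u x - u 0 with hv
  have hvu : u = v + u 0 • (1 : ℕ → ℝ≥0∞) := by
    funext x
    simp only [hv, Pi.add_apply, Pi.smul_apply, Pi.one_apply, smul_eq_mul, mul_one]
    exact (tsub_add_cancel_of_le (hum (Nat.zero_le x))).symm
  have hv0 : v 0 = 0 := by simp [hv]
  have hvle : v ≤ u := fun x => tsub_le_self
  have hvt : ∀ x, v x ≠ ⊤ := fun x => ne_top_of_le_ne_top (hu_top x) (hvle x)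
  have hRv : Rop v = v := by
    funext x; unfold Rop; split_ifs with h
    · rw [h, hv0]
    · rfl
  set c := (1 - α) * u 0 with hc
  have hct : c ≠ ⊤ := ENNReal.mul_ne_top (by simp) (hu_top 0)
  have hP1 : Pop μ 1 = 1 := by funext x; simp [Pop]
  have key : v + c • (1 : ℕ → ℝ≥0∞) = s + α • Qop μ v := by
    funext x
    have h1 := hu_eq x
    have h2 : Pop μ u = Qop μ v + u 0 • (1 : ℕ → ℝ≥0∞) := by
      conv_lhs => rw [hvu]
      rw [Pop_add, Pop_smul, hP1, Qop, hRv]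
    have h3 : u x = v x + u 0 := by
      have := congrFun hvu x
      simpa using this
    rw [h3, h2] at h1
    simp only [Pi.add_apply, Pi.smul_apply, Pi.one_apply, smul_eq_mul, mul_one] at h1 ⊢
    have h4 : u 0 = c + α * u 0 := by
      rw [hc, ← add_mul, tsub_add_cancel_of_le hα.le, one_mul]
    have h5 : (v x + c) + α * u 0 = (s x + α * Qop μ v x) + α * u 0 := by
      rw [add_assoc, ← h4, h1]; ring
    exact (ENNReal.add_left_inj (ENNReal.mul_ne_top hαt (hu_top 0))).1 h5
  have iter : ∀ N x, v x + c * ∑ n ∈ Finset.range N, α ^ n * (Qop μ)^[n] 1 x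
      = ∑ n ∈ Finset.range N, α ^ n * (Qop μ)^[n] s x + α ^ N * (Qop μ)^[N] v x := by
    intro N x
    induction N with
    | zero => simp
    | succ N ih =>
      have h := congrFun (congrArg ((Qop μ)^[N]) key) x
      rw [Qit_add, Qit_add, Qit_smul, Qit_smul, ← Function.iterate_succ_apply] at h
      simp only [Pi.add_apply, Pi.smul_apply, smul_eq_mul] at h
      rw [Finset.sum_range_succ, Finset.sum_range_succ, mul_add, ← add_assoc, ih]
      calc _ = ∑ n ∈ Finset.range N, α ^ n * (Qop μ)^[n] s x
            + α ^ N * ((Qop μ)^[N] v x + c * (Qop μ)^[N] 1 x) := by ring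
        _ = _ := by rw [h]; ring
  refine ⟨c, hct, v, ?_, hv0, hvt, fun x => ?_⟩
  · intro x y hxy
    exact tsub_le_tsub_right (hum hxy) _
  · have t1 : Tendsto (fun N => v x + c * ∑ n ∈ Finset.range N, α ^ n * (Qop μ)^[n] 1 x) atTop
        (𝓝 (v x + c * ∑' n, α ^ n * (Qop μ)^[n] 1 x)) :=
      tendsto_const_nhds.add
        (ENNReal.Tendsto.const_mul (ENNReal.tendsto_nat_tsum _) (Or.inr hct))
    have t3 : Tendsto (fun N => α ^ N * (Qop μ)^[N] v x) atTop (𝓝 0) := by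
      have h0 : Tendsto (fun N : ℕ => α ^ N * ((1 - α)⁻¹ * ((∫⁻ x, s x ∂π) / π {x}))) atTop
          (𝓝 0) := by
        simpa using ENNReal.Tendsto.mul_const (ENNReal.tendsto_pow_atTop_nhds_zero_of_lt_one hα)
          (Or.inr (hPu_top x))
      refine tendsto_of_tendsto_of_tendsto_of_le_of_le tendsto_const_nhds h0 (fun _ => zero_le) ?_
      intro N
      refine mul_le_mul_right ?_ _
      exact ((Qit_le_Pit μ N v x).trans ((Pop_mono' μ).iterate N hvle x)).trans (hPu N x)
    have t2 : Tendsto (fun N => ∑ n ∈ Finset.range N, α ^ n * (Qop μ)^[n] s x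
        + α ^ N * (Qop μ)^[N] v x) atTop (𝓝 (∑' n, α ^ n * (Qop μ)^[n] s x + 0)) :=
      (ENNReal.tendsto_nat_tsum _).add t3
    rw [add_zero] at t2
    refine tendsto_nhds_unique t1 ?_
    simp only [iter]
    exact t2

/-- Abel-type limit. -/
lemma abel_lim (a : ℕ → ℝ≥0∞) (ha : ∑' n, a n ≠ ⊤) (α : ℕ → ℝ≥0∞) (hα : ∀ k, α k ≤ 1)
    (hlim : Tendsto α atTop (𝓝 1)) :
    Tendsto (fun k => (∑' n, α k ^ n * a n).toReal) atTop (𝓝 (∑' n, a n).toReal) := by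
  refine (ENNReal.tendsto_toReal ha).comp ?_
  have := tendsto_lintegral_of_dominated_convergence (μ := Measure.count)
      (F := fun k n => α k ^ n * a n) (f := a) (bound := a)
      (fun n => measurable_of_countable _)
      (fun k => ae_of_all _ fun n => mul_le_of_le_one_left zero_le (pow_le_one₀ zero_le (hα k)))
      (by rwa [lintegral_count])
      (ae_of_all _ fun n => by
        have h1 : Tendsto (fun k => α k ^ n) atTop (𝓝 (1 ^ n)) :=
          ((ENNReal.continuous_pow n).tendsto 1).comp hlim
        have han : a n ≠ ⊤ := ENNReal.ne_top_of_tsum_ne_top ha n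
        simpa using ENNReal.Tendsto.mul_const h1 (Or.inr han))
  simpa [lintegral_count] using this

lemma S_eq (μ : ℕ → Measure ℕ) (s : ℕ → ℝ≥0∞) (x : ℕ) :
    ∑' n, (Qop μ)^[n] s x = s x + Qop μ (fun x => ∑' n, (Qop μ)^[n] s x) x := by
  rw [Qop_tsum, tsum_eq_zero_add' ENNReal.summable]
  simp only [Function.iterate_zero, id, Function.iterate_succ_apply']

lemma core (μ : ℕ → Measure ℕ) (π : Measure ℕ) [IsProbabilityMeasure π]
    (hp : ∀ x, IsProbabilityMeasure (μ x)) (hstat : π.bind μ = π)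
    (hmono : ∀ f : ℕ → ℝ≥0∞, Monotone f → Monotone (Pop μ f))
    (hpos : ∀ x, π {x} ≠ 0) (s : ℕ → ℝ≥0∞) (hs : Monotone s) (hst : ∀ x, s x ≠ ⊤)
    (hsπ : ∫⁻ x, s x ∂π ≠ ⊤)
    (hT : ∀ x, ∑' n, (Qop μ)^[n] 1 x ≠ ⊤)
    (hS : ∀ x, ∑' n, (Qop μ)^[n] s x ≠ ⊤)
    (g : ℕ → ℝ) (hg : ∀ x, g x = (∑' n, (Qop μ)^[n] s x).toReal
      - (∫⁻ x, s x ∂π).toReal * (∑' n, (Qop μ)^[n] 1 x).toReal) :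
    Monotone g ∧ ∀ x, ∫ y, g y ∂(μ x) - g x = -((s x).toReal - (∫⁻ x, s x ∂π).toReal) := by
  have hπT := pi_zero μ π hp hstat hT
  have hπS := stat_all μ π hp hstat hT s hst
  set S : ℕ → ℝ≥0∞ := fun x => ∑' n, (Qop μ)^[n] s x with hSdef
  set T : ℕ → ℝ≥0∞ := fun x => ∑' n, (Qop μ)^[n] 1 x with hTdef
  set b := (∫⁻ x, s x ∂π).toReal with hb
  have e1 : (π {0}).toReal * (T 0).toReal = 1 := by
    rw [← ENNReal.toReal_mul]; simp only [hTdef, hπT]; simp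
  have e2 : b = (π {0}).toReal * (S 0).toReal := by
    rw [← ENNReal.toReal_mul, hb, hπS]
  have hT0 : (T 0).toReal ≠ 0 := by
    intro h; rw [h] at e1; simp at e1
  have e3 : (S 0).toReal = b * (T 0).toReal := by
    rw [e2]; linear_combination -(S 0).toReal * e1
  have hg' : ∀ x, g x = (S x).toReal - b * (T x).toReal := hg
  have hg0 : g 0 = 0 := by rw [hg', e3]; ring
  constructor
  · set α : ℕ → ℝ≥0∞ := fun k => 1 - ((k : ℝ≥0∞) + 1)⁻¹ with hα
    have hα1 : ∀ k, α k < 1 := by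
      intro k
      exact ENNReal.sub_lt_self (by simp) (by simp) (by simp)
    have hαlim : Tendsto α atTop (𝓝 1) := by
      have h1 : Tendsto (fun k : ℕ => ((k : ℝ≥0∞) + 1)⁻¹) atTop (𝓝 0) := by
        have := (tendsto_add_atTop_iff_nat 1).2 ENNReal.tendsto_inv_nat_nhds_zero
        simpa using this
      have := ENNReal.Tendsto.sub (tendsto_const_nhds (x := (1 : ℝ≥0∞)) (f := atTop (α := ℕ))) h1
        (Or.inl (by simp))
      simpa using this
    have hα1' : ∀ k, α k ≤ 1 := fun k => (hα1 k).le
    choose c hc v hvm hv0 hvt hv using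
      fun k => disc μ π hp hstat hmono hpos s hs hsπ (α k) (hα1 k)
    have hTk : ∀ k x, ∑' n, α k ^ n * (Qop μ)^[n] 1 x ≠ ⊤ := fun k x =>
      ne_top_of_le_ne_top (hT x) (ENNReal.tsum_le_tsum fun n =>
        mul_le_of_le_one_left zero_le (pow_le_one₀ zero_le (hα1' k)))
    have hvr : ∀ k x, (v k x).toReal = (∑' n, α k ^ n * (Qop μ)^[n] s x).toReal
        - (c k).toReal * (∑' n, α k ^ n * (Qop μ)^[n] 1 x).toReal := by
      intro k x
      rw [← hv k x, ENNReal.toReal_add (hvt k x) (ENNReal.mul_ne_top (hc k) (hTk k x)),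
        ENNReal.toReal_mul]
      ring
    have hSl : ∀ x, Tendsto (fun k => (∑' n, α k ^ n * (Qop μ)^[n] s x).toReal) atTop
        (𝓝 (S x).toReal) := fun x => abel_lim _ (hS x) α hα1' hαlim
    have hTl : ∀ x, Tendsto (fun k => (∑' n, α k ^ n * (Qop μ)^[n] 1 x).toReal) atTop
        (𝓝 (T x).toReal) := fun x => abel_lim _ (hT x) α hα1' hαlim
    have hcl : Tendsto (fun k => (c k).toReal) atTop (𝓝 b) := by
      have h1 := (hSl 0).div (hTl 0) hT0
      rw [e3, mul_div_cancel_right₀ _ hT0] at h1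
      refine h1.congr' ?_
      filter_upwards [(hTl 0).eventually_ne hT0] with k hk
      have h2 := hvr k 0
      rw [hv0] at h2
      simp only [ENNReal.toReal_zero] at h2
      rw [Pi.div_apply]
      rw [div_eq_iff hk]
      linarith
    have hvl : ∀ x, Tendsto (fun k => (v k x).toReal) atTop (𝓝 (g x)) := by
      intro x
      rw [hg']
      simp only [hvr]
      exact (hSl x).sub (hcl.mul (hTl x))
    intro x y hxy
    refine le_of_tendsto_of_tendsto' (hvl x) (hvl y) fun k => ?_
    exact ENNReal.toReal_mono (hvt k y) (hvm k hxy)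
  · intro x
    have hSx : S x = s x + Qop μ S x := S_eq μ s x
    have hTx : T x = 1 + Qop μ T x := S_eq μ 1 x
    have hQS : Qop μ S x ≠ ⊤ := ne_top_of_le_ne_top (hS x) (hSx ▸ le_add_self : Qop μ S x ≤ S x)
    have hQT : Qop μ T x ≠ ⊤ := ne_top_of_le_ne_top (hT x) (hTx ▸ le_add_self : Qop μ T x ≤ T x)
    have hgR : ∀ y, g y = (Rop S y).toReal - b * (Rop T y).toReal := by
      intro y
      unfold Rop
      split_ifs with h
      · rw [h, hg0]; simp
      · exact hg' y
    have hi : ∀ f : ℕ → ℝ≥0∞, (∀ y, f y ≠ ⊤) → ∫⁻ y, Rop f y ∂(μ x) ≠ ⊤ →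
        Integrable (fun y => (Rop f y).toReal) (μ x) ∧
        ∫ y, (Rop f y).toReal ∂(μ x) = (Qop μ f x).toReal := by
      intro f hf h
      refine ⟨integrable_toReal_of_lintegral_ne_top (measurable_of_countable _).aemeasurable h, ?_⟩
      rw [integral_toReal (measurable_of_countable _).aemeasurable]
      · rfl
      · refine ae_of_all _ fun y => ?_
        exact lt_of_le_of_lt (Rop_le f y) (hf y).lt_top
    obtain ⟨i1, j1⟩ := hi S hS hQS
    obtain ⟨i2, j2⟩ := hi T hT hQT
    have : ∫ y, g y ∂(μ x) = (Qop μ S x).toReal - b * (Qop μ T x).toReal := by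
      simp only [hgR]
      rw [integral_sub i1 (i2.const_mul b), integral_const_mul, j1, j2]
    rw [this, hg', hSx, hTx, ENNReal.toReal_add (hst x) hQS, ENNReal.toReal_add (by simp) hQT]
    simp only [ENNReal.toReal_one]
    ring

/-- functional of the path: `f (p n)` on the event that `p` does not visit `0` in `[1, n]`. -/
noncomputable def tab (f : ℕ → ℝ≥0∞) : ℕ → (ℕ → ℕ) → ℝ≥0∞
  | 0, p => f (p 0)
  | n + 1, p => if p 1 = 0 then 0 else tab f n (fun k => p (1 + k))

lemma tab_measurable (f : ℕ → ℝ≥0∞) (n : ℕ) : Measurable (tab f n) := by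
  induction n with
  | zero => exact (measurable_of_countable f).comp (measurable_pi_apply 0)
  | succ n ih =>
    have he : tab f (n + 1) =
        fun p : ℕ → ℕ => if p 1 = 0 then 0 else tab f n (fun k => p (1 + k)) := by
      funext p; rfl
    rw [he]
    refine Measurable.ite ?_ measurable_const (ih.comp ?_)
    · exact (measurable_pi_apply 1) (MeasurableSet.of_discrete (s := {0}))
    · exact measurable_pi_lambda _ fun k => measurable_pi_apply _

open Classical in
lemma tab_eq (f : ℕ → ℝ≥0∞) (n : ℕ) (p : ℕ → ℕ) :
    tab f n p = if ∀ k, 1 ≤ k → k ≤ n → p k ≠ 0 then f (p n) else 0 := by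
  induction n generalizing p with
  | zero =>
    rw [if_pos]
    · rfl
    · intro k h1 h2; omega
  | succ n ih =>
    unfold tab
    rw [ih]
    by_cases h : p 1 = 0
    · rw [if_pos h, if_neg]
      intro h'; exact h' 1 le_rfl (by omega) h
    · rw [if_neg h]
      have : (∀ k, 1 ≤ k → k ≤ n → p (1 + k) ≠ 0) ↔ (∀ k, 1 ≤ k → k ≤ n + 1 → p k ≠ 0) := by
        constructor
        · intro h' k hk1 hk2
          rcases Nat.eq_or_lt_of_le hk1 with h3 | h3
          · rw [← h3]; exact h
          · have := h' (k - 1) (by omega) (by omega)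
            rwa [show 1 + (k - 1) = k by omega] at this
        · intro h' k hk1 hk2
          exact h' _ (by omega) (by omega)
      simp only [add_comm 1 n]
      by_cases hq : ∀ k, 1 ≤ k → k ≤ n + 1 → p k ≠ 0
      · rw [if_pos hq, if_pos (this.2 hq)]
      · rw [if_neg hq, if_neg (fun h' => hq (this.1 h'))]

lemma tab_tsum (f : ℕ → ℝ≥0∞) (p : ℕ → ℕ) (h : ∃ n : ℕ, 1 ≤ n ∧ p n = 0) :
    ∑' n, tab f n p = ∑ j ∈ Finset.range (sInf {n : ℕ | 1 ≤ n ∧ p n = 0}), f (p j) := by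
  classical
  have hm : sInf {n : ℕ | 1 ≤ n ∧ p n = 0} ∈ {n : ℕ | 1 ≤ n ∧ p n = 0} := Nat.sInf_mem h
  rw [tsum_eq_sum (s := Finset.range (sInf {n : ℕ | 1 ≤ n ∧ p n = 0}))]
  · refine Finset.sum_congr rfl fun j hj => ?_
    rw [tab_eq, if_pos]
    intro k hk1 hk2 hk0
    have h1 : sInf {n : ℕ | 1 ≤ n ∧ p n = 0} ≤ k := Nat.sInf_le ⟨hk1, hk0⟩
    have h2 := Finset.mem_range.1 hj
    omega
  · intro j hj
    rw [tab_eq, if_neg]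
    intro h'
    exact h' _ hm.1 (by simpa using hj) hm.2

section chain
variable {Ω : Type*} {mΩ : MeasurableSpace Ω}

lemma markov_lint
    (Pm : ℕ → Measure Ω) (hprob : ∀ x, IsProbabilityMeasure (Pm x))
    (X : ℕ → Ω → ℕ) (hX : ∀ n, Measurable (X n))
    (hMarkov : ∀ (x n : ℕ) (f : (ℕ → ℕ) → ℝ), Measurable f →
      Integrable (fun ω => f (fun k => X (n + k) ω)) (Pm x) →
      (Pm x)[(fun ω => f (fun k => X (n + k) ω)) |
          ⨆ i ∈ Set.Iic n, MeasurableSpace.comap (X i) inferInstance]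
        =ᵐ[Pm x] fun ω => ∫ ω', f (fun k => X k ω') ∂(Pm (X n ω)))
    (x : ℕ) (F : (ℕ → ℕ) → ℝ≥0∞) (hF : Measurable F) :
    ∫⁻ ω, F (fun k => X (1 + k) ω) ∂(Pm x)
      = ∫⁻ y, ∫⁻ ω, F (fun k => X k ω) ∂(Pm y) ∂((Pm x).map (X 1)) := by
  have hpath : Measurable (fun ω (k : ℕ) => X k ω) := measurable_pi_lambda _ hX
  have hpath1 : Measurable (fun ω (k : ℕ) => X (1 + k) ω) := measurable_pi_lambda _ fun k => hX _
  have hm : (⨆ i ∈ Set.Iic 1, MeasurableSpace.comap (X i) inferInstance) ≤ mΩ :=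
    iSup₂_le fun i _ => (hX i).comap_le
  have hbm : AEMeasurable (fun y => (Pm y).map (fun ω (k : ℕ) => X k ω)) ((Pm x).map (X 1)) :=
    (measurable_from_top).aemeasurable
  have hmeas : (Pm x).map (fun ω (k : ℕ) => X (1 + k) ω)
      = ((Pm x).map (X 1)).bind (fun y => (Pm y).map (fun ω (k : ℕ) => X k ω)) := by
    ext S hS
    rw [Measure.bind_apply hS hbm, Measure.map_apply hpath1 hS,
      lintegral_map (measurable_of_countable _) (hX 1)]
    have hind : Measurable (S.indicator (fun _ => (1 : ℝ))) := measurable_const.indicator hS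
    have hint : Integrable (fun ω => S.indicator (fun _ => (1 : ℝ)) (fun k => X (1 + k) ω))
        (Pm x) := by
      refine Integrable.of_bound (hind.comp hpath1).aestronglyMeasurable 1 (ae_of_all _ fun ω => ?_)
      by_cases h : (fun k => X (1 + k) ω) ∈ S <;> simp [h]
    have h1 := hMarkov x 1 _ hind hint
    have h2 := integral_condExp (μ := Pm x) hm
      (f := fun ω => S.indicator (fun _ => (1 : ℝ)) (fun k => X (1 + k) ω))
    rw [integral_congr_ae h1] at h2
    have h3 : ∀ y, ∫ ω', S.indicator (fun _ => (1 : ℝ)) (fun k => X k ω') ∂(Pm y)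
        = ((Pm y).map (fun ω (k : ℕ) => X k ω) S).toReal := by
      intro y
      rw [Measure.map_apply hpath hS]
      exact integral_indicator_one (μ := Pm y) (hpath hS)
    have h4 : ∫ ω', S.indicator (fun _ => (1 : ℝ)) (fun k => X (1 + k) ω') ∂(Pm x)
        = (Pm x ((fun ω (k : ℕ) => X (1 + k) ω) ⁻¹' S)).toReal :=
      integral_indicator_one (μ := Pm x) (hpath1 hS)
    simp only [h3] at h2
    rw [h4] at h2
    have hle : ∀ y, (Pm y).map (fun ω (k : ℕ) => X k ω) S ≤ 1 := by
      intro y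
      rw [Measure.map_apply hpath hS]
      exact prob_le_one
    have hmeas' : Measurable (fun ω => (Pm (X 1 ω)).map (fun ω (k : ℕ) => X k ω) S) :=
      (measurable_of_countable (fun y => (Pm y).map (fun ω (k : ℕ) => X k ω) S)).comp (hX 1)
    rw [integral_toReal hmeas'.aemeasurable
      (ae_of_all _ fun ω => (hle _).trans_lt ENNReal.one_lt_top)] at h2
    refine ((ENNReal.toReal_eq_toReal_iff' ?_ (measure_ne_top _ _)).1 h2).symm
    refine ne_top_of_le_ne_top ENNReal.one_ne_top
      ((lintegral_mono fun ω => hle (X 1 ω)).trans ?_)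
    simp
  have : ∫⁻ p, F p ∂((Pm x).map (fun ω (k : ℕ) => X (1 + k) ω)) = ∫⁻ p, F p
      ∂(((Pm x).map (X 1)).bind (fun y => (Pm y).map (fun ω (k : ℕ) => X k ω))) := by rw [hmeas]
  rw [lintegral_map hF hpath1, Measure.lintegral_bind hbm hF.aemeasurable] at this
  rw [this]
  congr 1
  funext y
  rw [lintegral_map hF hpath]

lemma lint_P (Pm : ℕ → Measure Ω) (X : ℕ → Ω → ℕ)
    (hstart : ∀ x, ∀ᵐ ω ∂(Pm x), X 0 ω = x) (hprob : ∀ x, IsProbabilityMeasure (Pm x))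
    (hM : ∀ (x : ℕ) (F : (ℕ → ℕ) → ℝ≥0∞), Measurable F →
      ∫⁻ ω, F (fun k => X (1 + k) ω) ∂(Pm x)
      = ∫⁻ y, ∫⁻ ω, F (fun k => X k ω) ∂(Pm y) ∂((Pm x).map (X 1)))
    (f : ℕ → ℝ≥0∞) (n x : ℕ) :
    ∫⁻ ω, f (X n ω) ∂(Pm x) = (Pop (fun x => (Pm x).map (X 1)))^[n] f x := by
  induction n generalizing x with
  | zero =>
    rw [lintegral_congr_ae (g := fun _ => f x)]
    · simp
    · filter_upwards [hstart x] with ω h; rw [h]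
  | succ n ih =>
    rw [Function.iterate_succ_apply']
    have := hM x (fun p => f (p n)) ((measurable_of_countable f).comp (measurable_pi_apply n))
    rw [add_comm n 1, this]
    simp only [ih]
    rfl

lemma lint_Q (Pm : ℕ → Measure Ω) (X : ℕ → Ω → ℕ)
    (hstart : ∀ x, ∀ᵐ ω ∂(Pm x), X 0 ω = x) (hprob : ∀ x, IsProbabilityMeasure (Pm x))
    (hM : ∀ (x : ℕ) (F : (ℕ → ℕ) → ℝ≥0∞), Measurable F →
      ∫⁻ ω, F (fun k => X (1 + k) ω) ∂(Pm x)
      = ∫⁻ y, ∫⁻ ω, F (fun k => X k ω) ∂(Pm y) ∂((Pm x).map (X 1)))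
    (f : ℕ → ℝ≥0∞) (n x : ℕ) :
    ∫⁻ ω, tab f n (fun k => X k ω) ∂(Pm x) = (Qop (fun x => (Pm x).map (X 1)))^[n] f x := by
  induction n generalizing x with
  | zero =>
    rw [lintegral_congr_ae (g := fun _ => f x)]
    · simp
    · filter_upwards [hstart x] with ω h; simp [tab, h]
  | succ n ih =>
    rw [Function.iterate_succ_apply']
    have := hM x (fun p => if p 0 = 0 then 0 else tab f n p)
      (Measurable.ite ((measurable_pi_apply 0) (MeasurableSet.of_discrete (s := {0})))
        measurable_const (tab_measurable f n))
    simp only [tab]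
    simp only [add_zero] at this
    rw [this]
    refine lintegral_congr fun y => ?_
    by_cases h : y = 0
    · rw [show ∀ w, Rop w y = 0 from fun w => if_pos h]
      rw [lintegral_congr_ae (g := fun _ => 0)]
      · simp
      · filter_upwards [hstart y] with ω h'; simp [h', h]
    · rw [show ∀ w, Rop w y = w y from fun w => if_neg h]
      rw [← ih]
      refine lintegral_congr_ae ?_
      filter_upwards [hstart y] with ω h'; simp [h', h]

end chain

/-- Theorem 1 of the paper: let `X` be an irreducible positive recurrent
stochastically monotone Markov chain on `ℤ₊` with stationary distribution `π`, and
`r` a π-integrable non-decreasing function.  Then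
`g₀(x) = E_x Σ_{j<τ} r_c(X_j)`, with `τ = inf{n ≥ 1 : X_n = 0}` and `r_c = r − πr`,
is a non-decreasing solution of Poisson's equation `(P − I)g₀ = −r_c`.
The chain is modelled by the family `Pm x = P_x` of path laws of the process `X`. -/
theorem stmt_17 {Ω : Type*} {mΩ : MeasurableSpace Ω}
    (Pm : ℕ → Measure Ω) (hprob : ∀ x, IsProbabilityMeasure (Pm x))
    (X : ℕ → Ω → ℕ) (hX : ∀ n, Measurable (X n))
    (hstart : ∀ x, Pm x {ω | X 0 ω = x} = 1)
    -- time-homogeneous Markov property: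
    (hMarkov : ∀ (x n : ℕ) (f : (ℕ → ℕ) → ℝ), Measurable f →
      Integrable (fun ω => f (fun k => X (n + k) ω)) (Pm x) →
      (Pm x)[(fun ω => f (fun k => X (n + k) ω)) |
          ⨆ i ∈ Set.Iic n, MeasurableSpace.comap (X i) inferInstance]
        =ᵐ[Pm x] fun ω => ∫ ω', f (fun k => X k ω') ∂(Pm (X n ω)))
    -- irreducibility:
    (hirred : ∀ x y : ℕ, ∃ n : ℕ, 0 < Pm x {ω | X n ω = y})
    -- stochastic monotonicity:
    (hmono : ∀ y : ℕ, Monotone (fun x : ℕ => Pm x {ω | y < X 1 ω}))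
    -- the first return time to 0:
    (τ : Ω → ℕ) (hτ : ∀ ω, τ ω = sInf {n : ℕ | 1 ≤ n ∧ X n ω = 0})
    -- positive recurrence:
    (hhit : ∀ x, ∀ᵐ ω ∂(Pm x), ∃ n : ℕ, 1 ≤ n ∧ X n ω = 0)
    (hposrec : ∀ x, Integrable (fun ω => (τ ω : ℝ)) (Pm x))
    -- stationary distribution:
    (π : Measure ℕ) [IsProbabilityMeasure π]
    (hstat : π.bind (fun x => (Pm x).map (X 1)) = π)
    -- π-integrable non-decreasing reward:
    (r : ℕ → ℝ) (hrmono : Monotone r) (hrπ : Integrable r π)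
    (habs : ∀ x, Integrable
      (fun ω => ∑ j ∈ Finset.range (τ ω), |r (X j ω) - ∫ w, r w ∂π|) (Pm x)) :
    Monotone (fun x : ℕ =>
      ∫ ω, (∑ j ∈ Finset.range (τ ω), (r (X j ω) - ∫ w, r w ∂π)) ∂(Pm x)) ∧
    ∀ x : ℕ,
      (∫ y, (∫ ω, (∑ j ∈ Finset.range (τ ω), (r (X j ω) - ∫ w, r w ∂π)) ∂(Pm y))
          ∂((Pm x).map (X 1)))
        - (∫ ω, (∑ j ∈ Finset.range (τ ω), (r (X j ω) - ∫ w, r w ∂π)) ∂(Pm x))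
      = -(r x - ∫ w, r w ∂π) := by
  have hst : ∀ x, ∀ᵐ ω ∂(Pm x), X 0 ω = x := fun x =>
    (mem_ae_iff_prob_eq_one ((hX 0) (MeasurableSet.of_discrete (s := {x})))).2 (hstart x)
  have hM := markov_lint Pm hprob X hX hMarkov
  have hP := lint_P Pm X hst hprob hM
  have hQ := lint_Q Pm X hst hprob hM
  set μ : ℕ → Measure ℕ := fun x => (Pm x).map (X 1) with hμ
  have hpath : Measurable (fun ω (k : ℕ) => X k ω) := measurable_pi_lambda _ hX
  have hp : ∀ x, IsProbabilityMeasure (μ x) := fun x =>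
    Measure.isProbabilityMeasure_map (hX 1).aemeasurable
  have hmono' : ∀ f : ℕ → ℝ≥0∞, Monotone f → Monotone (Pop μ f) := by
    intro f hf
    refine Pop_monotone μ hp (fun y => ?_) hf
    have : (fun x => μ x (Ioi y)) = fun x : ℕ => Pm x {ω | y < X 1 ω} := by
      funext x
      exact Measure.map_apply (hX 1) measurableSet_Ioi
    rw [this]
    exact hmono y
  -- the sum up to `τ`
  have htsum : ∀ f : ℕ → ℝ≥0∞, ∀ x, ∀ᵐ ω ∂(Pm x),
      ∑' n, tab f n (fun k => X k ω) = ∑ j ∈ Finset.range (τ ω), f (X j ω) := by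
    intro f x
    filter_upwards [hhit x] with ω h
    rw [tab_tsum f (fun k => X k ω) h, hτ ω]
  have htm : ∀ f : ℕ → ℝ≥0∞, Measurable (fun ω => ∑' n, tab f n (fun k => X k ω)) := fun f =>
    Measurable.tsum fun n => (tab_measurable f n).comp hpath
  have htl : ∀ (f : ℕ → ℝ≥0∞) x, ∫⁻ ω, ∑' n, tab f n (fun k => X k ω) ∂(Pm x)
      = ∑' n, (Qop μ)^[n] f x := by
    intro f x
    have h1 := lintegral_tsum (μ := Pm x) (f := fun n ω => tab f n (fun k => X k ω))
      fun n => ((tab_measurable f n).comp hpath).aemeasurable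
    rw [h1]
    exact tsum_congr fun n => hQ f n x
  have hT : ∀ x, ∑' n, (Qop μ)^[n] 1 x ≠ ⊤ := by
    intro x
    rw [← htl, lintegral_congr_ae (htsum 1 x)]
    have h := (hposrec x).lintegral_lt_top.ne
    simpa using h
  have hπ0 : π {0} ≠ 0 := by
    intro h
    have := pi_zero μ π hp hstat hT
    rw [h, zero_mul] at this
    exact zero_ne_one this
  have hpos : ∀ x, π {x} ≠ 0 := by
    intro x h
    obtain ⟨n, hn⟩ := hirred 0 x
    have h1 := mul_le_lint π ((Pop μ)^[n] (({x} : Set ℕ).indicator 1)) 0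
    rw [stat_Pit μ π hstat, lintegral_indicator_one (MeasurableSet.singleton x), h, ← hP] at h1
    have h2 : ∫⁻ ω, ({x} : Set ℕ).indicator 1 (X n ω) ∂(Pm 0) = Pm 0 {ω | X n ω = x} :=
      lintegral_indicator_one (μ := Pm 0) ((hX n) (MeasurableSet.singleton x))
    rw [h2] at h1
    exact (mul_ne_zero hπ0 hn.ne') (le_antisymm h1 zero_le)
  set m := ∫ w, r w ∂π with hm
  set s : ℕ → ℝ≥0∞ := fun x => ENNReal.ofReal (r x - r 0) with hs
  have hr0 : ∀ x, 0 ≤ r x - r 0 := fun x => sub_nonneg.2 (hrmono (Nat.zero_le x))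
  have hsr : ∀ x, (s x).toReal = r x - r 0 := fun x => ENNReal.toReal_ofReal (hr0 x)
  have hsi : Integrable (fun x => r x - r 0) π := hrπ.sub (integrable_const _)
  have hsπ : ∫⁻ x, s x ∂π ≠ ⊤ := hsi.lintegral_lt_top.ne
  have hb : (∫⁻ x, s x ∂π).toReal = m - r 0 := by
    rw [← integral_toReal (measurable_of_countable _).aemeasurable
      (ae_of_all _ fun x => ENNReal.ofReal_lt_top), integral_congr_ae (ae_of_all _ hsr),
      integral_sub hrπ (integrable_const _)]
    simp [hm]
  have hS : ∀ x, ∑' n, (Qop μ)^[n] s x ≠ ⊤ := by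
    intro x
    have h1 : s ≤ (fun y => ENNReal.ofReal |r y - m|)
        + ENNReal.ofReal |m - r 0| • (1 : ℕ → ℝ≥0∞) := by
      intro y
      simp only [hs, Pi.add_apply, Pi.smul_apply, Pi.one_apply, smul_eq_mul, mul_one]
      rw [← ENNReal.ofReal_add (abs_nonneg _) (abs_nonneg _)]
      refine ENNReal.ofReal_le_ofReal ?_
      linarith [le_abs_self (r y - m), le_abs_self (m - r 0)]
    have h2 : ∑' n, (Qop μ)^[n] (fun y => ENNReal.ofReal |r y - m|) x ≠ ⊤ := by
      rw [← htl, lintegral_congr_ae (htsum _ x)]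
      have h := (habs x).lintegral_lt_top.ne
      rw [lintegral_congr (g := fun ω => ENNReal.ofReal
        (∑ j ∈ Finset.range (τ ω), |r (X j ω) - m|))]
      · exact h
      · intro ω
        rw [ENNReal.ofReal_sum_of_nonneg fun _ _ => abs_nonneg _]
    have h3 : ∑' n, (Qop μ)^[n] s x ≤ ∑' n, (Qop μ)^[n] (fun y => ENNReal.ofReal |r y - m|) x
        + ENNReal.ofReal |m - r 0| * ∑' n, (Qop μ)^[n] 1 x := by
      rw [← ENNReal.tsum_mul_left, ← ENNReal.tsum_add]
      refine ENNReal.tsum_le_tsum fun n => ?_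
      have := Qit_mono μ n h1 x
      rwa [Qit_add, Qit_smul] at this
    exact ne_top_of_le_ne_top
      (ENNReal.add_ne_top.2 ⟨h2, ENNReal.mul_ne_top ENNReal.ofReal_ne_top (hT x)⟩) h3
  have hint : ∀ f : ℕ → ℝ≥0∞, ∀ x, ∑' n, (Qop μ)^[n] f x ≠ ⊤ →
      Integrable (fun ω => (∑' n, tab f n (fun k => X k ω)).toReal) (Pm x) ∧
      ∫ ω, (∑' n, tab f n (fun k => X k ω)).toReal ∂(Pm x)
        = (∑' n, (Qop μ)^[n] f x).toReal := by
    intro f x hf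
    rw [← htl] at hf ⊢
    exact ⟨integrable_toReal_of_lintegral_ne_top (htm f).aemeasurable hf,
      integral_toReal (htm f).aemeasurable (ae_lt_top (htm f) hf)⟩
  have hg : ∀ x, ∫ ω, (∑ j ∈ Finset.range (τ ω), (r (X j ω) - m)) ∂(Pm x)
      = (∑' n, (Qop μ)^[n] s x).toReal
      - (∫⁻ x, s x ∂π).toReal * (∑' n, (Qop μ)^[n] 1 x).toReal := by
    intro x
    obtain ⟨i1, j1⟩ := hint s x (hS x)
    obtain ⟨i2, j2⟩ := hint 1 x (hT x)
    rw [← j1, ← j2, ← integral_const_mul, ← integral_sub i1 (i2.const_mul _)]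
    refine integral_congr_ae ?_
    filter_upwards [htsum s x, htsum 1 x] with ω h1 h2
    rw [h1, h2, ENNReal.toReal_sum (fun _ _ => ENNReal.ofReal_ne_top), hb]
    rw [Finset.sum_congr rfl fun j _ => hsr (X j ω)]
    simp only [Finset.sum_sub_distrib, Finset.sum_const, Finset.card_range, nsmul_eq_mul,
      Pi.one_apply, mul_one, ENNReal.toReal_natCast]
    ring
  have hsm : Monotone s := fun x y hxy =>
    ENNReal.ofReal_le_ofReal (sub_le_sub_right (hrmono hxy) _)
  obtain ⟨c1, c2⟩ := core μ π hp hstat hmono' hpos s hsm (fun x => ENNReal.ofReal_ne_top) hsπ hT hS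
    (fun x => ∫ ω, (∑ j ∈ Finset.range (τ ω), (r (X j ω) - m)) ∂(Pm x)) hg
  refine ⟨c1, fun x => ?_⟩
  have h := c2 x
  rw [hsr, hb] at h
  rw [show r x - m = r x - r 0 - (m - r 0) by ring]
  exact h
end
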